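/- Assume f : ℝⁿ → ℝ and g : ℝᵐ → ℝ are differentiable convex functions with ∇f L₁-Lipschitz and ∇g L₂-Lipschitz, K : ℝⁿ → ℝᵐ is linear with adjoint K*. In the dynamical system (15) take α(t) = α/t and β(t) = t^b with constants α ≥ b + 3, b ≥ 0, 1/(α − 1) ≤ θ ≤ 1/(b + 2), and t₀ ≥ 1; let ε : [t₀, ∞) → (0, ∞) be C¹ and nonincreasing, let (x(t), y(t)) be a twice continuously differentiable global solution of (15), and let (x*, y*) be a saddle point of L. Then: (1) if ∫_{t₀}^∞ t^{b+1} ε(t) dt < ∞, the trajectory (x(t), y(t)) is bounded and there is C > 0 with (a) L(x(t), y*) − L(x*, y(t)) ≤ C t^{−b−2}, (b) ‖ẋ(t)‖ ≤ C/t and ‖ẏ(t)‖ ≤ C/t, (c) ‖∇f(x(t)) − ∇f(x*)‖ ≤ C t^{−(b+2)/2} and ‖∇g(y(t)) − ∇g(y*)‖ ≤ C t^{−(b+2)/2} for all t ≥ t₀; if moreover 1/(α − 1) < θ ≤ 1/(b + 2) then ∫_{t₀}^∞ t(‖ẋ(t)‖² + ‖ẏ(t)‖²) dt < ∞; if moreover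 1/(α − 1) ≤ θ < 1/(b + 2) then ∫_{t₀}^∞ t^{b+1}(L(x(t), y*) − L(x*, y(t))) dt < ∞, ∫_{t₀}^∞ t^{b+1}‖∇f(x(t)) − ∇f(x*)‖² dt < ∞, and ∫_{t₀}^∞ t^{b+1}‖∇g(y(t)) − ∇g(y*)‖² dt < ∞; (2) if ∫_{t₀}^∞ t^{b−1} ε(t) dt < ∞, then ‖ẋ(t)‖ → 0, ‖ẏ(t)‖ → 0, and L(x(t), y*) − L(x*, y(t)) → 0 as t → ∞; if in addition b > 0 then L(x(t), y*) − L(x*, y(t)) = o(t^{−b}), ‖∇f(x(t)) − ∇f(x*)‖ = o(t^{−b/2}), and ‖∇g(y(t)) − ∇g(y*)‖ = o(t^{−b/2}). -/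

import Mathlib

open scoped RealInnerProductSpace
open MeasureTheory Filter Asymptotics

noncomputable section

/-- The bilinear Lagrangian `L(x, y) = f(x) + ⟨Kx, y⟩ - g(y)`. -/
def Lag {n m : ℕ} (f : EuclideanSpace ℝ (Fin n) → ℝ) (g : EuclideanSpace ℝ (Fin m) → ℝ)
    (K : EuclideanSpace ℝ (Fin n) →L[ℝ] EuclideanSpace ℝ (Fin m))
    (x : EuclideanSpace ℝ (Fin n)) (y : EuclideanSpace ℝ (Fin m)) : ℝ :=
  f x + ⟪K x, y⟫ - g y

/-- `(x*, y*)` is a saddle point of the Lagrangian `L`: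
`L(x*, y) ≤ L(x*, y*) ≤ L(x, y*)` for all `(x, y)`. -/
def IsSaddle {n m : ℕ} (f : EuclideanSpace ℝ (Fin n) → ℝ) (g : EuclideanSpace ℝ (Fin m) → ℝ)
    (K : EuclideanSpace ℝ (Fin n) →L[ℝ] EuclideanSpace ℝ (Fin m))
    (xs : EuclideanSpace ℝ (Fin n)) (ys : EuclideanSpace ℝ (Fin m)) : Prop :=
  ∀ x y, Lag f g K xs y ≤ Lag f g K xs ys ∧ Lag f g K xs ys ≤ Lag f g K x ys

/-- `(x, y)` is a twice continuously differentiable global solution on `[t₀, ∞)` of the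
Tikhonov regularized second-order primal-dual dynamical system (15):
`ẍ + α(t)ẋ + β(t)[∇f(x) + ε(t)x + K*(y + θtẏ)] = 0`,
`ÿ + α(t)ẏ − β(t)[K(x + θtẋ) − ∇g(y) − ε(t)y] = 0`. -/
def IsSol {n m : ℕ} (t₀ θ : ℝ)
    (f : EuclideanSpace ℝ (Fin n) → ℝ) (g : EuclideanSpace ℝ (Fin m) → ℝ)
    (K : EuclideanSpace ℝ (Fin n) →L[ℝ] EuclideanSpace ℝ (Fin m))
    (α β ε : ℝ → ℝ)
    (x : ℝ → EuclideanSpace ℝ (Fin n)) (y : ℝ → EuclideanSpace ℝ (Fin m)) : Prop :=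
  ContDiffOn ℝ 2 x (Set.Ici t₀) ∧ ContDiffOn ℝ 2 y (Set.Ici t₀) ∧
  ∀ t ≥ t₀,
    deriv (deriv x) t + α t • deriv x t
      + β t • (gradient f (x t) + ε t • x t
        + (ContinuousLinearMap.adjoint K) (y t + (θ * t) • deriv y t)) = 0 ∧
    deriv (deriv y) t + α t • deriv y t
      - β t • (K (x t + (θ * t) • deriv x t) - gradient g (y t) - ε t • y t) = 0

/-- Gradient inequality for convex functions. -/
lemma aux_grad_ineq {V : Type*} [NormedAddCommGroup V] [InnerProductSpace ℝ V] [CompleteSpace V]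
    (f : V → ℝ) (hf : Differentiable ℝ f) (hc : ConvexOn ℝ Set.univ f) (u w : V) :
    f u + ⟪gradient f u, w - u⟫ ≤ f w := by
  have hd : HasDerivAt (fun s : ℝ => f (AffineMap.lineMap u w s)) ⟪gradient f u, w - u⟫ 0 := by
    have h1 : HasFDerivAt f (InnerProductSpace.toDual ℝ V (gradient f u))
        (AffineMap.lineMap u w (0:ℝ)) := by
      simpa using (hf u).hasGradientAt.hasFDerivAt
    have h2 : HasDerivAt (fun s : ℝ => (AffineMap.lineMap u w s : V)) (w - u) 0 :=
      AffineMap.hasDerivAt_lineMap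
    exact h1.comp_hasDerivAt (0:ℝ) h2
  have hconv : ConvexOn ℝ Set.univ (fun s : ℝ => f (AffineMap.lineMap u w s)) := by
    exact hc.comp_affineMap (AffineMap.lineMap u w)
  have := hconv.le_slope_of_hasDerivAt (Set.mem_univ 0) (Set.mem_univ 1) one_pos hd
  simp only [slope_def_field, AffineMap.lineMap_apply_one, AffineMap.lineMap_apply_zero, sub_zero, div_one] at this
  linarith

/-- Descent lemma. -/
lemma aux_descent {V : Type*} [NormedAddCommGroup V] [InnerProductSpace ℝ V] [CompleteSpace V]
    (f : V → ℝ) (L : ℝ) (hf : Differentiable ℝ f)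
    (hL : ∀ u v, ‖gradient f u - gradient f v‖ ≤ L * ‖u - v‖) (u d : V) :
    f (u + d) ≤ f u + ⟪gradient f u, d⟫ + L / 2 * ‖d‖ ^ 2 := by
  set ψ : ℝ → ℝ := fun s => f (u + s • d) - s * ⟪gradient f u, d⟫ - L / 2 * s ^ 2 * ‖d‖ ^ 2
    with hψ
  have hd : ∀ s, HasDerivAt ψ (⟪gradient f (u + s • d), d⟫ - ⟪gradient f u, d⟫
      - L * s * ‖d‖ ^ 2) s := by
    intro s
    have h1 : HasFDerivAt f (InnerProductSpace.toDual ℝ V (gradient f (u + s • d)))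
        (u + s • d) := (hf _).hasGradientAt.hasFDerivAt
    have h2 : HasDerivAt (fun s : ℝ => u + s • d) d s := by
      simpa using ((hasDerivAt_id s).smul_const d).const_add u
    have h3 : HasDerivAt (fun s : ℝ => f (u + s • d)) ⟪gradient f (u + s • d), d⟫ s := by
      exact h1.comp_hasDerivAt s h2
    have h4 := (h3.sub ((hasDerivAt_id s).mul_const ⟪gradient f u, d⟫)).sub
      ((((hasDerivAt_id s).pow 2).const_mul (L/2)).mul_const (‖d‖^2))
    refine h4.congr_deriv ?_
    simp only [id, Nat.cast_ofNat, pow_one, Nat.add_one_sub_one]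
    ring
  have hanti : AntitoneOn ψ (Set.Icc 0 1) := by
    apply antitoneOn_of_deriv_nonpos (convex_Icc 0 1)
    · exact fun s _ => (hd s).continuousAt.continuousWithinAt
    · exact fun s _ => (hd s).differentiableAt.differentiableWithinAt
    · intro s hs
      rw [interior_Icc] at hs
      rw [(hd s).deriv, ← inner_sub_left]
      have h1 := real_inner_le_norm (gradient f (u + s • d) - gradient f u) d
      have h2 := hL (u + s • d) u
      have h3 : ‖u + s • d - u‖ = s * ‖d‖ := by
        rw [add_sub_cancel_left, norm_smul, Real.norm_of_nonneg hs.1.le]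
      rw [h3] at h2
      have := mul_le_mul_of_nonneg_right h2 (norm_nonneg d)
      nlinarith
  have := hanti (Set.left_mem_Icc.2 zero_le_one) (Set.right_mem_Icc.2 zero_le_one) zero_le_one
  simp only [hψ, one_smul, zero_smul, add_zero, one_mul, zero_mul, one_pow, mul_one, sub_zero, ne_eq, OfNat.ofNat_ne_zero, not_false_eq_true, zero_pow, mul_zero] at this
  linarith

/-- Strengthened gradient inequality for convex functions with Lipschitz gradient. -/
lemma aux_cocoercive {V : Type*} [NormedAddCommGroup V] [InnerProductSpace ℝ V] [CompleteSpace V]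
    (f : V → ℝ) (L : ℝ) (hLpos : 0 < L) (hf : Differentiable ℝ f) (hc : ConvexOn ℝ Set.univ f)
    (hL : ∀ u v, ‖gradient f u - gradient f v‖ ≤ L * ‖u - v‖) (u w : V) :
    f u + ⟪gradient f u, w - u⟫ + 1 / (2 * L) * ‖gradient f w - gradient f u‖ ^ 2 ≤ f w := by
  set D := gradient f w - gradient f u with hD
  have h1 := aux_descent f L hf hL w (-(1 / L) • D)
  have h2 := aux_grad_ineq f hf hc u (w + -(1 / L) • D)
  have h3 : ⟪D, D⟫ = ‖D‖ ^ 2 := real_inner_self_eq_norm_sq D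
  have h4 : ⟪gradient f w, D⟫ - ⟪gradient f u, D⟫ = ‖D‖ ^ 2 := by
    rw [← h3, ← inner_sub_left]
  rw [show w + -(1 / L) • D - u = (w - u) + -(1 / L) • D by abel, inner_add_right,
    inner_smul_right] at h2
  rw [inner_smul_right, norm_smul, norm_neg, Real.norm_of_nonneg (by positivity), mul_pow] at h1
  have h5 : L / 2 * ((1 / L) ^ 2 * ‖D‖ ^ 2) = 1 / (2 * L) * ‖D‖ ^ 2 := by
    field_simp
  have h6 : (1 / L) * (⟪gradient f w, D⟫ - ⟪gradient f u, D⟫) = 2 * (1 / (2 * L) * ‖D‖ ^ 2) := by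
    rw [h4]; field_simp
  rw [h5] at h1
  linarith

/-- Integrated energy inequality. -/
lemma aux_energy (t₀ : ℝ) (E E' q r : ℝ → ℝ) (hE : ContinuousOn E (Set.Ici t₀))
    (hd : ∀ t > t₀, HasDerivAt E (E' t) t)
    (hq : ContinuousOn q (Set.Ici t₀)) (hr : ContinuousOn r (Set.Ici t₀))
    (hle : ∀ t > t₀, E' t ≤ r t - q t) (t : ℝ) (ht : t₀ ≤ t) :
    E t + ∫ s in t₀..t, q s ≤ E t₀ + ∫ s in t₀..t, r s := by
  have hq' : ContinuousOn q (Set.uIcc t₀ t) := by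
    rw [Set.uIcc_of_le ht]; exact hq.mono Set.Icc_subset_Ici_self
  have hr' : ContinuousOn r (Set.uIcc t₀ t) := by
    rw [Set.uIcc_of_le ht]; exact hr.mono Set.Icc_subset_Ici_self
  have h := intervalIntegral.sub_le_integral_of_hasDeriv_right_of_le ht
    (hE.mono Set.Icc_subset_Ici_self) (fun s hs => (hd s hs.1).hasDerivWithinAt)
    (φ := fun s => r s - q s)
    (((hr.sub hq).mono Set.Icc_subset_Ici_self).integrableOn_Icc)
    (fun s hs => hle s hs.1)
  rw [intervalIntegral.integral_sub hr'.intervalIntegrable hq'.intervalIntegrable] at h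
  linarith

/-- A nonnegative continuous function with bounded partial integrals is integrable. -/
lemma aux_integrable (t₀ B : ℝ) (q : ℝ → ℝ) (hq : ContinuousOn q (Set.Ici t₀))
    (h0 : ∀ t ≥ t₀, 0 ≤ q t) (hB : ∀ t ≥ t₀, ∫ s in t₀..t, q s ≤ B) :
    IntegrableOn q (Set.Ioi t₀) := by
  refine integrableOn_Ioi_of_intervalIntegral_norm_bounded (b := fun i : ℝ => i) (l := atTop) B t₀
    ?_ tendsto_id ?_
  · intro i
    exact ((hq.mono Set.Icc_subset_Ici_self).integrableOn_Icc).mono_set Set.Ioc_subset_Icc_self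
  · filter_upwards [eventually_ge_atTop t₀] with t ht
    refine le_trans (le_of_eq ?_) (hB t ht)
    refine intervalIntegral.integral_congr fun s hs => ?_
    rw [Set.uIcc_of_le ht] at hs
    exact Real.norm_of_nonneg (h0 s hs.1)

/-- Kronecker type lemma. -/
lemma aux_kronecker (t₀ : ℝ) (ht₀ : 1 ≤ t₀) (ρ : ℝ → ℝ) (hρ : IntegrableOn ρ (Set.Ioi t₀)) :
    Tendsto (fun t => (∫ s in t₀..t, s ^ 2 * ρ s) / t ^ 2) atTop (nhds 0) := by
  have key : Tendsto (fun t : ℝ => ∫ s in Set.Ioi t₀,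
      (Set.Iic t).indicator (fun s => (s / t) ^ 2 * ρ s) s) atTop
      (nhds (∫ s in Set.Ioi t₀, (0 : ℝ))) := by
    refine tendsto_integral_filter_of_dominated_convergence (fun s => ‖ρ s‖) ?_ ?_ hρ.norm ?_
    · refine Eventually.of_forall fun t => ?_
      refine AEStronglyMeasurable.indicator ?_ measurableSet_Iic
      exact (Measurable.aestronglyMeasurable (by fun_prop)).mul hρ.aestronglyMeasurable
    · filter_upwards [eventually_ge_atTop t₀] with t ht
      filter_upwards [ae_restrict_mem measurableSet_Ioi] with s hs
      have hs' : t₀ < s := hs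
      by_cases hst : s ∈ Set.Iic t
      · rw [Set.indicator_of_mem hst, norm_mul]
        have hst' : s ≤ t := hst
        have h1 : (s / t) ^ 2 ≤ 1 := by
          apply pow_le_one₀
          · apply div_nonneg <;> linarith
          · rw [div_le_one (by linarith)]; exact hst'
        rw [Real.norm_of_nonneg (by positivity)]
        exact mul_le_of_le_one_left (norm_nonneg _) h1
      · rw [Set.indicator_of_notMem hst]; simp
    · refine Eventually.of_forall fun s => ?_
      have h1 : Tendsto (fun t : ℝ => (s / t) ^ 2 * ρ s) atTop (nhds 0) := by
        have : Tendsto (fun t : ℝ => s / t) atTop (nhds 0) := tendsto_const_nhds.div_atTop tendsto_id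
        simpa using (this.pow 2).mul_const (ρ s)
      refine h1.congr' ?_
      filter_upwards [eventually_ge_atTop s] with t ht
      rw [Set.indicator_of_mem (show s ∈ Set.Iic t from ht)]
  simp only [integral_zero] at key
  refine key.congr' ?_
  filter_upwards [eventually_ge_atTop t₀] with t ht
  rw [setIntegral_indicator measurableSet_Iic, Set.Ioi_inter_Iic,
    intervalIntegral.integral_of_le ht, ← integral_div]
  refine integral_congr_ae (Eventually.of_forall fun s => ?_)
  simp only
  rw [div_pow]; ring

/-- Integrated Lyapunov inequality for the abstract system. -/
lemma aux_core {V : Type*} [NormedAddCommGroup V] [InnerProductSpace ℝ V]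
    (t₀ θ a b κ : ℝ) (ht₀ : 1 ≤ t₀) (hθ : 0 < θ) (hθb : (b + 2) * θ ≤ 1)
    (z v γ j : ℝ → V) (p : V) (h e e' : ℝ → ℝ)
    (hz : ContinuousOn z (Set.Ici t₀)) (hv : ContinuousOn v (Set.Ici t₀))
    (hγ : ContinuousOn γ (Set.Ici t₀))
    (hh : ContinuousOn h (Set.Ici t₀)) (he : ContinuousOn e (Set.Ici t₀))
    (hzd : ∀ t > t₀, HasDerivAt z (v t) t)
    (hvd : ∀ t > t₀, HasDerivAt v (-(a / t) • v t - t ^ b • (γ t + e t • z t + j t)) t)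
    (hj : ∀ t > t₀, ⟪j t, z t - p + (θ * t) • v t⟫ = 0)
    (hhd : ∀ t > t₀, HasDerivAt h ⟪γ t, v t⟫ t)
    (hed : ∀ t > t₀, HasDerivAt e (e' t) t) (hepos : ∀ t ≥ t₀, 0 < e t)
    (he' : ∀ t > t₀, e' t ≤ 0)
    (hc1 : ∀ t ≥ t₀, h t + κ * ‖γ t‖ ^ 2 ≤ ⟪γ t, z t - p⟫)
    (E : ℝ → ℝ) (hE : E = fun t => θ ^ 2 * t ^ (b + 2) * (h t + e t / 2 * ‖z t‖ ^ 2)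
      + 1 / 2 * ‖z t - p + (θ * t) • v t‖ ^ 2 + (θ * (a - 1) - 1) / 2 * ‖z t - p‖ ^ 2)
    (t : ℝ) (ht : t₀ ≤ t) :
    E t + ∫ s in t₀..t, (θ * (1 - (b + 2) * θ) * (s ^ (b + 1) * h s)
        + θ * (θ * (a - 1) - 1) * (s * ‖v s‖ ^ 2) + θ * κ * (s ^ (b + 1) * ‖γ s‖ ^ 2))
      ≤ E t₀ + ∫ s in t₀..t, θ / 2 * ‖p‖ ^ 2 * (s ^ (b + 1) * e s) := by
  have hrp : ∀ c : ℝ, ContinuousOn (fun s : ℝ => s ^ c) (Set.Ici t₀) := fun c =>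
    continuousOn_id.rpow_const fun s hs => Or.inl (by
      have : t₀ ≤ s := hs
      simp only [id]; linarith)
  have hu : ∀ t > t₀, HasDerivAt (fun t => z t - p + (θ * t) • v t)
      (-(θ * (a - 1) - 1) • v t - (θ * t ^ (b + 1)) • (γ t + e t • z t + j t)) t := by
    intro t ht
    have htpos : 0 < t := by linarith
    have h1 := ((hzd t ht).sub_const p).add
      (((hasDerivAt_id t).const_mul θ).smul (hvd t ht))
    refine h1.congr_deriv ?_
    rw [Real.rpow_add_one htpos.ne']
    simp only [id, smul_sub, smul_smul]
    have h2 : θ * t * -(a / t) = - (θ * a) := by field_simp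
    rw [h2]
    module
  refine aux_energy t₀ E (fun t => (θ ^ 2 * ((b + 2) * t ^ (b + 1))) * (h t + e t / 2 * ‖z t‖ ^ 2)
      + θ ^ 2 * t ^ (b + 2) * (⟪γ t, v t⟫ + (e' t / 2 * ‖z t‖ ^ 2 + e t / 2 * (2 * ⟪z t, v t⟫)))
      + 1 / 2 * (2 * ⟪z t - p + (θ * t) • v t, -(θ * (a - 1) - 1) • v t
        - (θ * t ^ (b + 1)) • (γ t + e t • z t + j t)⟫)
      + (θ * (a - 1) - 1) / 2 * (2 * ⟪z t - p, v t⟫)) _ _ ?_ ?_ ?_ ?_ ?_ t ht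
  · rw [hE]
    have := hrp (b + 2)
    fun_prop
  · intro t ht
    have htpos : 0 < t := by linarith
    have h1 : HasDerivAt (fun t : ℝ => t ^ (b + 2)) ((b + 2) * t ^ (b + 1)) t := by
      have := Real.hasDerivAt_rpow_const (x := t) (p := b + 2) (Or.inl htpos.ne')
      rwa [show b + 2 - 1 = b + 1 by ring] at this
    rw [hE]
    exact (((h1.const_mul (θ ^ 2)).mul ((hhd t ht).add
      (((hed t ht).div_const 2).mul (hzd t ht).norm_sq))).add
      ((hu t ht).norm_sq.const_mul (1 / 2))).add
      (((hzd t ht).sub_const p).norm_sq.const_mul ((θ * (a - 1) - 1) / 2))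
  · have := hrp (b + 1)
    fun_prop
  · have := hrp (b + 1)
    fun_prop
  · intro t ht
    have htpos : 0 < t := by linarith
    have hT : t ^ (b + 2) = t ^ (b + 1) * t := by
      rw [← Real.rpow_add_one htpos.ne']; congr 1; ring
    have hTpos : 0 < t ^ (b + 1) := Real.rpow_pos_of_pos htpos _
    have hep := hepos t ht.le
    have hj' := hj t ht
    have hc := hc1 t ht.le
    have hen := he' t ht
    rw [hT, inner_sub_right, inner_smul_right, inner_smul_right, inner_add_right, inner_add_right,
      inner_smul_right, real_inner_comm (j t), hj', inner_add_left _ _ (v t),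
      inner_add_left _ _ (γ t), inner_add_left _ _ (z t), inner_smul_left, inner_smul_left,
      inner_smul_left, real_inner_self_eq_norm_sq, real_inner_comm (γ t) (v t),
      real_inner_comm (γ t) (z t - p), real_inner_comm (z t) (v t),
      real_inner_comm (z t) (z t - p)]
    simp only [RCLike.conj_to_real]
    have hzp : 1 / 2 * ‖z t‖ ^ 2 - 1 / 2 * ‖p‖ ^ 2 ≤ ⟪z t, z t - p⟫ := by
      have h1 := norm_sub_sq_real (z t) p
      rw [inner_sub_right, real_inner_self_eq_norm_sq]
      nlinarith [sq_nonneg ‖z t - p‖]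
    generalize ⟪z t, z t - p⟫ = zw at *
    generalize ⟪γ t, z t - p⟫ = gw at *
    generalize ⟪γ t, v t⟫ = gv at *
    generalize ⟪z t, v t⟫ = zv at *
    generalize ⟪z t - p, v t⟫ = wv at *
    have hZ := sq_nonneg ‖z t‖
    generalize ‖z t‖ ^ 2 = Z at *
    generalize ‖γ t‖ ^ 2 = G at *
    generalize ‖v t‖ ^ 2 = W at *
    generalize ‖p‖ ^ 2 = P at *
    generalize t ^ (b + 1) = T at *
    have k1 : 0 ≤ (θ * T) * (gw - (h t + κ * G)) :=
      mul_nonneg (by positivity) (by linarith)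
    have k2 : 0 ≤ (θ * T * e t) * (zw - (1 / 2 * Z - 1 / 2 * P)) :=
      mul_nonneg (by positivity) (by linarith)
    have k3 : 0 ≤ (θ ^ 2 * t * T) * ((- e' t) * Z / 2) :=
      mul_nonneg (by positivity) (div_nonneg (mul_nonneg (by linarith) hZ) (by norm_num))
    have k4 : 0 ≤ (θ * T * e t * Z / 2) * (1 - (b + 2) * θ) :=
      mul_nonneg (by positivity) (by linarith)
    nlinarith [k1, k2, k3, k4]

/-- Bound on the distance to the saddle point from the bound on `z - p + θ t z'`. -/
lemma aux_dist {V : Type*} [NormedAddCommGroup V] [InnerProductSpace ℝ V]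
    (t₀ θ : ℝ) (ht₀ : 1 ≤ t₀) (hθ : 0 < θ) (z v : ℝ → V) (p : V)
    (hz : ContinuousOn z (Set.Ici t₀))
    (hzd : ∀ t > t₀, HasDerivAt z (v t) t) (T B : ℝ) (hT : t₀ ≤ T) (hB : 0 ≤ B)
    (hu : ∀ t, t₀ ≤ t → t ≤ T → 1 / 2 * ‖z t - p + (θ * t) • v t‖ ^ 2 ≤ B) :
    1 / 2 * ‖z T - p‖ ^ 2 ≤ 1 / 2 * ‖z t₀ - p‖ ^ 2 + B := by
  set φ : ℝ → ℝ := fun s => s ^ (1 / θ) * (1 / 2 * ‖z s - p‖ ^ 2 - B) with hφ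
  have hd : ∀ s > t₀, HasDerivAt φ (1 / θ * s ^ (1 / θ - 1) * (1 / 2 * ‖z s - p‖ ^ 2 - B)
      + s ^ (1 / θ) * (1 / 2 * (2 * ⟪z s - p, v s⟫))) s := by
    intro s hs
    have hspos : 0 < s := by linarith
    exact (Real.hasDerivAt_rpow_const (Or.inl hspos.ne')).mul
      ((((hzd s hs).sub_const p).norm_sq.const_mul (1 / 2)).sub_const B)
  have hanti : AntitoneOn φ (Set.Icc t₀ T) := by
    apply antitoneOn_of_deriv_nonpos (convex_Icc _ _)
    · have h1 : ContinuousOn (fun s : ℝ => s ^ (1 / θ)) (Set.Icc t₀ T) :=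
        continuousOn_id.rpow_const fun s hs => Or.inl (by
          have := hs.1
          simp only [id]; linarith)
      have h2 : ContinuousOn z (Set.Icc t₀ T) := hz.mono Set.Icc_subset_Ici_self
      fun_prop
    · intro s hs
      rw [interior_Icc] at hs
      exact (hd s hs.1).differentiableAt.differentiableWithinAt
    · intro s hs
      rw [interior_Icc] at hs
      have hspos : 0 < s := by linarith [hs.1]
      rw [(hd s hs.1).deriv]
      have h1 := hu s hs.1.le hs.2.le
      rw [norm_add_sq_real, inner_smul_right] at h1
      have h3 : s ^ (1 / θ) = s ^ (1 / θ - 1) * s := by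
        rw [← Real.rpow_add_one hspos.ne']; congr 1; ring
      rw [h3]
      have hTpos : 0 < s ^ (1 / θ - 1) := Real.rpow_pos_of_pos hspos _
      have h4 : 1 / θ * s ^ (1 / θ - 1) * (1 / 2 * ‖z s - p‖ ^ 2 - B)
          + s ^ (1 / θ - 1) * s * (1 / 2 * (2 * ⟪z s - p, v s⟫)) =
          (s ^ (1 / θ - 1) / θ) * (1 / 2 * ‖z s - p‖ ^ 2 - B + θ * s * ⟪z s - p, v s⟫) := by
        field_simp
      rw [h4]
      apply mul_nonpos_of_nonneg_of_nonpos (by positivity)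
      nlinarith [sq_nonneg ‖(θ * s) • v s‖]
  have h := hanti (Set.left_mem_Icc.2 hT) (Set.right_mem_Icc.2 hT) hT
  simp only [hφ] at h
  have ht₀p : 0 < t₀ := by linarith
  have h1 : 0 < t₀ ^ (1 / θ) := Real.rpow_pos_of_pos ht₀p _
  have h2 : t₀ ^ (1 / θ) ≤ T ^ (1 / θ) := Real.rpow_le_rpow ht₀p.le hT (by positivity)
  by_contra hcon
  push Not at hcon
  have h3 : T ^ (1 / θ) * (1 / 2 * ‖z t₀ - p‖ ^ 2) < T ^ (1 / θ) * (1 / 2 * ‖z T - p‖ ^ 2 - B) :=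
    mul_lt_mul_of_pos_left (by linarith) (by linarith)
  have h4 : t₀ ^ (1 / θ) * (1 / 2 * ‖z t₀ - p‖ ^ 2) ≤ T ^ (1 / θ) * (1 / 2 * ‖z t₀ - p‖ ^ 2) :=
    mul_le_mul_of_nonneg_right h2 (by positivity)
  have h5 : 0 ≤ t₀ ^ (1 / θ) * B := by positivity
  nlinarith

/-- The abstract convergence result. -/
lemma aux_abs {V : Type*} [NormedAddCommGroup V] [InnerProductSpace ℝ V]
    (t₀ θ a b κ : ℝ) (ht₀ : 1 ≤ t₀) (hθ : 0 < θ) (hθb : (b + 2) * θ ≤ 1)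
    (hθa : 1 ≤ θ * (a - 1)) (hκ : 0 < κ)
    (z v γ j : ℝ → V) (p : V) (h e e' : ℝ → ℝ)
    (hz : ContinuousOn z (Set.Ici t₀)) (hv : ContinuousOn v (Set.Ici t₀))
    (hγ : ContinuousOn γ (Set.Ici t₀))
    (hh : ContinuousOn h (Set.Ici t₀)) (he : ContinuousOn e (Set.Ici t₀))
    (hzd : ∀ t > t₀, HasDerivAt z (v t) t)
    (hvd : ∀ t > t₀, HasDerivAt v (-(a / t) • v t - t ^ b • (γ t + e t • z t + j t)) t)
    (hj : ∀ t > t₀, ⟪j t, z t - p + (θ * t) • v t⟫ = 0)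
    (hhd : ∀ t > t₀, HasDerivAt h ⟪γ t, v t⟫ t)
    (hed : ∀ t > t₀, HasDerivAt e (e' t) t) (hepos : ∀ t ≥ t₀, 0 < e t)
    (he' : ∀ t > t₀, e' t ≤ 0)
    (hc1 : ∀ t ≥ t₀, h t + κ * ‖γ t‖ ^ 2 ≤ ⟪γ t, z t - p⟫)
    (hc2 : ∀ t ≥ t₀, κ * ‖γ t‖ ^ 2 ≤ h t) :
    (IntegrableOn (fun t => t ^ (b + 1) * e t) (Set.Ioi t₀) →
      (∃ M : ℝ, 0 ≤ M ∧ ∀ t ≥ t₀, ‖z t - p‖ ^ 2 ≤ M ∧ t ^ (b + 2) * h t ≤ M ∧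
        t ^ 2 * ‖v t‖ ^ 2 ≤ M ∧ t ^ (b + 2) * ‖γ t‖ ^ 2 ≤ M) ∧
      (1 < θ * (a - 1) → IntegrableOn (fun t => t * ‖v t‖ ^ 2) (Set.Ioi t₀)) ∧
      ((b + 2) * θ < 1 → IntegrableOn (fun t => t ^ (b + 1) * h t) (Set.Ioi t₀)) ∧
      IntegrableOn (fun t => t ^ (b + 1) * ‖γ t‖ ^ 2) (Set.Ioi t₀)) ∧
    (IntegrableOn (fun t => t ^ (b - 1) * e t) (Set.Ioi t₀) →
      Tendsto (fun t => ‖v t‖ ^ 2) atTop (nhds 0) ∧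
      Tendsto (fun t => t ^ b * h t) atTop (nhds 0) ∧
      Tendsto (fun t => t ^ b * ‖γ t‖ ^ 2) atTop (nhds 0)) := by
  have hrp : ∀ c : ℝ, ContinuousOn (fun s : ℝ => s ^ c) (Set.Ici t₀) := fun c =>
    continuousOn_id.rpow_const fun s hs => Or.inl (by
      have : t₀ ≤ s := hs
      simp only [id]; linarith)
  have hpos : ∀ t ≥ t₀, 0 < t := fun t ht => by linarith
  have hrpos : ∀ c : ℝ, ∀ t ≥ t₀, 0 < t ^ c := fun c t ht => Real.rpow_pos_of_pos (hpos t ht) c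
  have hh0 : ∀ t ≥ t₀, 0 ≤ h t := fun t ht => le_trans (by positivity) (hc2 t ht)
  have hb1 := hrp (b + 1)
  set E : ℝ → ℝ := fun t => θ ^ 2 * t ^ (b + 2) * (h t + e t / 2 * ‖z t‖ ^ 2)
      + 1 / 2 * ‖z t - p + (θ * t) • v t‖ ^ 2 + (θ * (a - 1) - 1) / 2 * ‖z t - p‖ ^ 2 with hE
  set q : ℝ → ℝ := fun s => θ * (1 - (b + 2) * θ) * (s ^ (b + 1) * h s)
        + θ * (θ * (a - 1) - 1) * (s * ‖v s‖ ^ 2) + θ * κ * (s ^ (b + 1) * ‖γ s‖ ^ 2) with hq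
  set r : ℝ → ℝ := fun s => θ / 2 * ‖p‖ ^ 2 * (s ^ (b + 1) * e s) with hr
  have hcore : ∀ t, t₀ ≤ t → E t + ∫ s in t₀..t, q s ≤ E t₀ + ∫ s in t₀..t, r s :=
    fun t ht => aux_core t₀ θ a b κ ht₀ hθ hθb z v γ j p h e e' hz hv hγ hh he hzd hvd hj hhd hed
      hepos he' hc1 E hE t ht
  have hqc : ContinuousOn q (Set.Ici t₀) := by fun_prop
  have hrc : ContinuousOn r (Set.Ici t₀) := by fun_prop
  have hq1 : ∀ t ≥ t₀, 0 ≤ θ * (1 - (b + 2) * θ) * (t ^ (b + 1) * h t) := fun t ht =>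
    mul_nonneg (mul_nonneg hθ.le (by linarith)) (mul_nonneg (hrpos _ t ht).le (hh0 t ht))
  have hq2 : ∀ t ≥ t₀, 0 ≤ θ * (θ * (a - 1) - 1) * (t * ‖v t‖ ^ 2) := fun t ht =>
    mul_nonneg (mul_nonneg hθ.le (by linarith)) (mul_nonneg (hpos t ht).le (by positivity))
  have hq3 : ∀ t ≥ t₀, 0 ≤ θ * κ * (t ^ (b + 1) * ‖γ t‖ ^ 2) := fun t ht =>
    mul_nonneg (by positivity) (mul_nonneg (hrpos _ t ht).le (by positivity))
  have hq0 : ∀ t ≥ t₀, 0 ≤ q t := fun t ht =>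
    add_nonneg (add_nonneg (hq1 t ht) (hq2 t ht)) (hq3 t ht)
  have hr0 : ∀ t ≥ t₀, 0 ≤ r t := fun t ht =>
    mul_nonneg (by positivity) (mul_nonneg (hrpos _ t ht).le (hepos t ht).le)
  have hE1 : ∀ t ≥ t₀, 0 ≤ θ ^ 2 * t ^ (b + 2) * h t := fun t ht =>
    mul_nonneg (mul_nonneg (by positivity) (hrpos _ t ht).le) (hh0 t ht)
  have hE2 : ∀ t ≥ t₀, 0 ≤ θ ^ 2 * t ^ (b + 2) * (e t / 2 * ‖z t‖ ^ 2) := fun t ht =>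
    mul_nonneg (mul_nonneg (by positivity) (hrpos _ t ht).le)
      (mul_nonneg (by linarith [hepos t ht]) (by positivity))
  have hE3 : ∀ t, 0 ≤ (θ * (a - 1) - 1) / 2 * ‖z t - p‖ ^ 2 := fun t =>
    mul_nonneg (by linarith) (by positivity)
  have hE4 : ∀ t, 0 ≤ 1 / 2 * ‖z t - p + (θ * t) • v t‖ ^ 2 := fun t => by positivity
  have hEexp : ∀ t, E t = θ ^ 2 * t ^ (b + 2) * h t + θ ^ 2 * t ^ (b + 2) * (e t / 2 * ‖z t‖ ^ 2)
      + 1 / 2 * ‖z t - p + (θ * t) • v t‖ ^ 2 + (θ * (a - 1) - 1) / 2 * ‖z t - p‖ ^ 2 := by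
    intro t; simp only [hE]; ring
  have hE0 : ∀ t ≥ t₀, 0 ≤ E t := fun t ht => by
    rw [hEexp]
    linarith [hE1 t ht, hE2 t ht, hE3 t, hE4 t]
  have hint : ∀ (k : ℝ → ℝ), ContinuousOn k (Set.Ici t₀) → ∀ s t, t₀ ≤ s → s ≤ t →
      IntervalIntegrable k volume s t := fun k hk s t hs hst => by
    apply ContinuousOn.intervalIntegrable
    rw [Set.uIcc_of_le hst]
    exact hk.mono (fun x hx => le_trans hs hx.1)
  have hqi : ∀ t ≥ t₀, 0 ≤ ∫ s in t₀..t, q s := fun t ht =>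
    intervalIntegral.integral_nonneg ht fun s hs => hq0 s hs.1
  have hri : ∀ t ≥ t₀, 0 ≤ ∫ s in t₀..t, r s := fun t ht =>
    intervalIntegral.integral_nonneg ht fun s hs => hr0 s hs.1
  have hrmono : ∀ s t, t₀ ≤ s → s ≤ t → ∫ x in t₀..s, r x ≤ ∫ x in t₀..t, r x := by
    intro s t hs hst
    rw [← intervalIntegral.integral_add_adjacent_intervals (hint r hrc t₀ s le_rfl hs)
      (hint r hrc s t hs hst)]
    have := intervalIntegral.integral_nonneg (f := r) (μ := volume) hst
      fun x hx => hr0 x (le_trans hs hx.1)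
    linarith
  set η : ℝ → ℝ := fun t => (E t₀ + 1 / 2 * ‖z t₀ - p‖ ^ 2) + ∫ s in t₀..t, r s with hη
  have hN0 : 0 ≤ 1 / 2 * ‖z t₀ - p‖ ^ 2 := by positivity
  have hηh : ∀ t ≥ t₀, θ ^ 2 * (t ^ (b + 2) * h t) ≤ η t := by
    intro t ht
    have h1 := hcore t ht
    rw [hEexp t] at h1
    simp only [hη]
    nlinarith [hE1 t ht, hE2 t ht, hE3 t, hE4 t, hqi t ht]
  have hηu : ∀ t ≥ t₀, 1 / 2 * ‖z t - p + (θ * t) • v t‖ ^ 2 ≤ E t₀ + ∫ s in t₀..t, r s := by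
    intro t ht
    have h1 := hcore t ht
    rw [hEexp t] at h1
    linarith [hE1 t ht, hE2 t ht, hE3 t, hE4 t, hqi t ht]
  have hηq : ∀ t ≥ t₀, ∫ s in t₀..t, q s ≤ η t := by
    intro t ht
    have h1 := hcore t ht
    simp only [hη]
    linarith [hE0 t ht]
  have hηz : ∀ t ≥ t₀, 1 / 2 * ‖z t - p‖ ^ 2 ≤ η t := by
    intro T hT
    have := aux_dist t₀ θ ht₀ hθ z v p hz hzd T (E t₀ + ∫ s in t₀..T, r s) hT
      (add_nonneg (hE0 t₀ le_rfl) (hri T hT))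
      (fun t ht htT => le_trans (hηu t ht) (by linarith [hrmono t T ht htT]))
    simp only [hη]; linarith
  have hηv : ∀ t ≥ t₀, θ ^ 2 * (t ^ 2 * ‖v t‖ ^ 2) ≤ 8 * η t := by
    intro t ht
    have h1 : ‖(θ * t) • v t‖ ≤ ‖z t - p + (θ * t) • v t‖ + ‖z t - p‖ := by
      have := norm_sub_le (z t - p + (θ * t) • v t) (z t - p)
      rwa [add_sub_cancel_left] at this
    have h2 : ‖(θ * t) • v t‖ = θ * t * ‖v t‖ := by
      rw [norm_smul, Real.norm_of_nonneg (mul_nonneg hθ.le (hpos t ht).le)]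
    have h3 : (θ * t * ‖v t‖) ^ 2 ≤ (‖z t - p + (θ * t) • v t‖ + ‖z t - p‖) ^ 2 := by
      rw [← h2]; exact pow_le_pow_left₀ (norm_nonneg _) h1 2
    have h4 := hηz t ht
    have h5 : 1 / 2 * ‖z t - p + (θ * t) • v t‖ ^ 2 ≤ η t := by
      have := hηu t ht
      simp only [hη]; linarith
    nlinarith [sq_nonneg (‖z t - p + (θ * t) • v t‖ - ‖z t - p‖)]
  have hηg : ∀ t ≥ t₀, θ ^ 2 * κ * (t ^ (b + 2) * ‖γ t‖ ^ 2) ≤ η t := by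
    intro t ht
    refine le_trans ?_ (hηh t ht)
    have := mul_le_mul_of_nonneg_left (hc2 t ht)
      (mul_nonneg (sq_nonneg θ) (hrpos (b + 2) t ht).le)
    nlinarith
  constructor
  · intro hI
    have hI' : IntegrableOn r (Set.Ioi t₀) := hI.const_mul _
    set M := (E t₀ + 1 / 2 * ‖z t₀ - p‖ ^ 2) + ∫ s in Set.Ioi t₀, r s with hM
    have hηM : ∀ t ≥ t₀, η t ≤ M := by
      intro t ht
      simp only [hη, hM]
      rw [intervalIntegral.integral_of_le ht]
      have := setIntegral_mono_set hI' (s := Set.Ioc t₀ t) (by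
        filter_upwards [ae_restrict_mem measurableSet_Ioi] with s hs
        exact hr0 s (le_of_lt hs)) (Set.Ioc_subset_Ioi_self.eventuallyLE)
      linarith
    have hM0 : 0 ≤ M := by
      have := hηz t₀ le_rfl
      linarith [hηM t₀ le_rfl]
    have hqInt : ∀ (k : ℝ → ℝ) (d : ℝ), 0 < d → ContinuousOn k (Set.Ici t₀) →
        (∀ t ≥ t₀, 0 ≤ k t) → (∀ t ≥ t₀, d * k t ≤ q t) → IntegrableOn k (Set.Ioi t₀) := by
      intro k d hd hk hk0 hkq
      refine aux_integrable t₀ (M / d) k hk hk0 fun t ht => ?_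
      rw [le_div_iff₀ hd, mul_comm, ← intervalIntegral.integral_const_mul]
      refine le_trans ?_ ((hηq t ht).trans (hηM t ht))
      exact intervalIntegral.integral_mono_on ht
        (hint _ (hk.const_mul d) t₀ t le_rfl ht) (hint _ hqc t₀ t le_rfl ht)
        fun s hs => hkq s hs.1
    refine ⟨⟨2 * M + M / θ ^ 2 + 8 * M / θ ^ 2 + M / (θ ^ 2 * κ), by positivity, ?_⟩, ?_, ?_, ?_⟩
    · intro t ht
      have e1 : 0 ≤ M / θ ^ 2 := by positivity
      have e2 : 0 ≤ 8 * M / θ ^ 2 := by positivity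
      have e3 : 0 ≤ M / (θ ^ 2 * κ) := by positivity
      have f0 := hηM t ht
      have f1 := hηz t ht
      have f2 : t ^ (b + 2) * h t ≤ M / θ ^ 2 := by
        rw [le_div_iff₀ (by positivity), mul_comm]
        exact (hηh t ht).trans f0
      have f3 : t ^ 2 * ‖v t‖ ^ 2 ≤ 8 * M / θ ^ 2 := by
        rw [le_div_iff₀ (by positivity), mul_comm]
        exact (hηv t ht).trans (by linarith)
      have f4 : t ^ (b + 2) * ‖γ t‖ ^ 2 ≤ M / (θ ^ 2 * κ) := by
        rw [le_div_iff₀ (by positivity), mul_comm]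
        exact (hηg t ht).trans f0
      refine ⟨?_, ?_, ?_, ?_⟩ <;> linarith
    · intro hlt
      refine hqInt _ (θ * (θ * (a - 1) - 1)) (mul_pos hθ (by linarith)) (by fun_prop) ?_ ?_
      · intro t ht; exact mul_nonneg (hpos t ht).le (by positivity)
      · intro t ht
        simp only [hq]
        linarith [hq1 t ht, hq3 t ht]
    · intro hlt
      refine hqInt _ (θ * (1 - (b + 2) * θ)) (mul_pos hθ (by linarith)) (by fun_prop) ?_ ?_
      · intro t ht; exact mul_nonneg (hrpos _ t ht).le (hh0 t ht)
      · intro t ht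
        simp only [hq]
        linarith [hq2 t ht, hq3 t ht]
    · refine hqInt _ (θ * κ) (by positivity) (by fun_prop) ?_ ?_
      · intro t ht; exact mul_nonneg (hrpos _ t ht).le (by positivity)
      · intro t ht
        simp only [hq]
        linarith [hq1 t ht, hq2 t ht]
  · intro hI
    have hηt : Tendsto (fun t => η t / t ^ 2) atTop (nhds 0) := by
      have h1 := aux_kronecker t₀ ht₀ _ (hI.const_mul (θ / 2 * ‖p‖ ^ 2))
      have h2 : Tendsto (fun t : ℝ => (E t₀ + 1 / 2 * ‖z t₀ - p‖ ^ 2) / t ^ 2) atTop (nhds 0) :=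
        tendsto_const_nhds.div_atTop (tendsto_pow_atTop two_ne_zero)
      have h3 := h2.add h1
      rw [add_zero] at h3
      refine h3.congr' ?_
      filter_upwards [eventually_ge_atTop t₀] with t ht
      have hcg : (∫ s in t₀..t, s ^ 2 * (θ / 2 * ‖p‖ ^ 2 * (s ^ (b - 1) * e s)))
          = ∫ s in t₀..t, r s := by
        refine intervalIntegral.integral_congr fun s hs => ?_
        rw [Set.uIcc_of_le ht] at hs
        have hs0 := hpos s hs.1
        have : s ^ (b + 1) = s ^ 2 * s ^ (b - 1) := by
          rw [← Real.rpow_natCast s 2, ← Real.rpow_add hs0]; congr 1; push_cast; ring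
        simp only [hr, this]; ring
      simp only [hη]
      rw [hcg, ← add_div]
    have hsq : ∀ (k : ℝ → ℝ) (d : ℝ), 0 < d → (∀ t ≥ t₀, 0 ≤ k t) →
        (∀ t ≥ t₀, d * (t ^ 2 * k t) ≤ η t) → Tendsto k atTop (nhds 0) := by
      intro k d hd hk0 hk
      have h1 : Tendsto (fun t => 1 / d * (η t / t ^ 2)) atTop (nhds 0) := by
        simpa using hηt.const_mul (1 / d)
      refine squeeze_zero' ?_ ?_ h1
      · filter_upwards [eventually_ge_atTop t₀] with t ht using hk0 t ht
      · filter_upwards [eventually_ge_atTop t₀] with t ht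
        have := hpos t ht
        rw [one_div_mul_eq_div, le_div_iff₀ hd, le_div_iff₀ (by positivity)]
        linarith [hk t ht]
    have hb2 : ∀ t ≥ t₀, t ^ (b + 2) = t ^ 2 * t ^ b := by
      intro t ht
      rw [← Real.rpow_natCast t 2, ← Real.rpow_add (hpos t ht)]; congr 1; push_cast; ring
    refine ⟨hsq _ (θ ^ 2 / 8) (by positivity) (fun t _ => by positivity) ?_,
      hsq _ (θ ^ 2) (by positivity) (fun t ht => mul_nonneg (hrpos _ t ht).le (hh0 t ht)) ?_,
      hsq _ (θ ^ 2 * κ) (by positivity)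
        (fun t ht => mul_nonneg (hrpos _ t ht).le (by positivity)) ?_⟩
    · intro t ht; linarith [hηv t ht]
    · intro t ht
      have := hηh t ht
      rw [hb2 t ht] at this; linarith
    · intro t ht
      have := hηg t ht
      rw [hb2 t ht] at this; linarith

lemma aux_traj {V : Type*} [NormedAddCommGroup V] [NormedSpace ℝ V] (t₀ : ℝ) (x : ℝ → V)
    (hx : ContDiffOn ℝ 2 x (Set.Ici t₀)) :
    ∃ v : ℝ → V, ContinuousOn x (Set.Ici t₀) ∧ ContinuousOn v (Set.Ici t₀) ∧
      (∀ t > t₀, HasDerivAt x (v t) t) ∧ (∀ t > t₀, v t = deriv x t) ∧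
      (∀ t > t₀, HasDerivAt v (deriv (deriv x) t) t) := by
  have hu : UniqueDiffOn ℝ (Set.Ici t₀) := uniqueDiffOn_Ici t₀
  have h1 : ContDiffOn ℝ 1 (derivWithin x (Set.Ici t₀)) (Set.Ici t₀) :=
    hx.derivWithin hu (by norm_num)
  have heq : ∀ t > t₀, derivWithin x (Set.Ici t₀) t = deriv x t := fun t ht =>
    derivWithin_of_mem_nhds (Ici_mem_nhds ht)
  refine ⟨derivWithin x (Set.Ici t₀), hx.continuousOn, h1.continuousOn, ?_, heq, ?_⟩
  · intro t ht
    rw [heq t ht]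
    exact ((hx.contDiffAt (Ici_mem_nhds ht)).differentiableAt (by norm_num)).hasDerivAt
  · intro t ht
    have h2 := ((h1.contDiffAt (Ici_mem_nhds ht)).differentiableAt (by norm_num)).hasDerivAt
    have h3 : derivWithin x (Set.Ici t₀) =ᶠ[nhds t] deriv x := by
      filter_upwards [Ioi_mem_nhds ht] with s hs using heq s hs
    rwa [h3.deriv_eq] at h2

lemma aux_toLp_deriv {V W : Type*} [NormedAddCommGroup V] [NormedSpace ℝ V]
    [NormedAddCommGroup W] [NormedSpace ℝ W] (x : ℝ → V) (y : ℝ → W) (x' : V) (y' : W) (t : ℝ)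
    (hx : HasDerivAt x x' t) (hy : HasDerivAt y y' t) :
    HasDerivAt (fun t => WithLp.toLp 2 (x t, y t)) (WithLp.toLp 2 (x', y')) t :=
  (WithLp.prodContinuousLinearEquiv 2 ℝ V W).symm.hasFDerivAt.comp_hasDerivAt t (hx.prodMk hy)

lemma aux_toLp_cont {V W : Type*} [NormedAddCommGroup V] [NormedSpace ℝ V]
    [NormedAddCommGroup W] [NormedSpace ℝ W] (x : ℝ → V) (y : ℝ → W) (s : Set ℝ)
    (hx : ContinuousOn x s) (hy : ContinuousOn y s) :
    ContinuousOn (fun t => WithLp.toLp 2 (x t, y t)) s :=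
  (WithLp.prodContinuousLinearEquiv 2 ℝ V W).symm.continuous.comp_continuousOn (hx.prodMk hy)

lemma aux_toLp_norm {V W : Type*} [NormedAddCommGroup V] [InnerProductSpace ℝ V]
    [NormedAddCommGroup W] [InnerProductSpace ℝ W] (x : V) (y : W) :
    ‖WithLp.toLp 2 (x, y)‖ ^ 2 = ‖x‖ ^ 2 + ‖y‖ ^ 2 := by
  simp [WithLp.prod_norm_sq_eq_of_L2]

lemma aux_toLp_inner {V W : Type*} [NormedAddCommGroup V] [InnerProductSpace ℝ V]
    [NormedAddCommGroup W] [InnerProductSpace ℝ W] (x x' : V) (y y' : W) :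
    ⟪WithLp.toLp 2 (x, y), WithLp.toLp 2 (x', y')⟫ = ⟪x, x'⟫ + ⟪y, y'⟫ := by
  simp [WithLp.prod_inner_apply]

lemma aux_opt {V : Type*} [NormedAddCommGroup V] [InnerProductSpace ℝ V] [CompleteSpace V]
    (f : V → ℝ) (hf : Differentiable ℝ f) (w u : V)
    (hmin : ∀ x, f u + ⟪w, u⟫ ≤ f x + ⟪w, x⟫) : gradient f u = -w := by
  have h1 : HasFDerivAt f (InnerProductSpace.toDual ℝ V (gradient f u)) u :=
    (hf u).hasGradientAt.hasFDerivAt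
  have h2 : HasFDerivAt (fun x => f x + ⟪w, x⟫)
      (InnerProductSpace.toDual ℝ V (gradient f u) + InnerProductSpace.toDual ℝ V w) u :=
    h1.add (InnerProductSpace.toDual ℝ V w).hasFDerivAt
  have h3 : IsLocalMin (fun x => f x + ⟪w, x⟫) u := Eventually.of_forall hmin
  have h4 := h3.hasFDerivAt_eq_zero h2
  rw [← map_add] at h4
  have h5 : gradient f u + w = 0 := by
    simpa only [map_eq_zero_iff _ (InnerProductSpace.toDual ℝ V).injective] using h4
  exact eq_neg_of_add_eq_zero_left h5

lemma aux_sq_tendsto (k m : ℝ → ℝ) (hk : ∀ t, 0 ≤ k t) (hkm : ∀ᶠ t in atTop, k t ^ 2 ≤ m t)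
    (hm : Tendsto m atTop (nhds 0)) : Tendsto k atTop (nhds 0) := by
  have h1 : Tendsto (fun t => √(m t)) atTop (nhds 0) := by
    have := (Real.continuous_sqrt.tendsto 0).comp hm
    rwa [Real.sqrt_zero] at this
  refine squeeze_zero' (Eventually.of_forall hk) ?_ h1
  filter_upwards [hkm] with t ht using Real.le_sqrt_of_sq_le ht

lemma aux_toLp_sub {V W : Type*} [NormedAddCommGroup V] [InnerProductSpace ℝ V]
    [NormedAddCommGroup W] [InnerProductSpace ℝ W] (x x' : V) (y y' : W) :
    WithLp.toLp 2 (x, y) - WithLp.toLp 2 (x', y') = WithLp.toLp 2 (x - x', y - y') := rfl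

lemma aux_toLp_add {V W : Type*} [NormedAddCommGroup V] [InnerProductSpace ℝ V]
    [NormedAddCommGroup W] [InnerProductSpace ℝ W] (x x' : V) (y y' : W) :
    WithLp.toLp 2 (x, y) + WithLp.toLp 2 (x', y') = WithLp.toLp 2 (x + x', y + y') := rfl

lemma aux_toLp_smul {V W : Type*} [NormedAddCommGroup V] [InnerProductSpace ℝ V]
    [NormedAddCommGroup W] [InnerProductSpace ℝ W] (c : ℝ) (x : V) (y : W) :
    c • WithLp.toLp 2 (x, y) = WithLp.toLp 2 (c • x, c • y) := rfl

set_option maxHeartbeats 4000000 in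
/-- Theorem 3.4, Case 1: `α(t) = a/t`, `β(t) = t^b`: convergence rates
and integral estimates under fast (`∫ t^{b+1}ε(t) dt < ∞`) and slow
(`∫ t^{b−1}ε(t) dt < ∞`) Tikhonov decay. -/
theorem stmt_18 {n m : ℕ} (t₀ θ a b L₁ L₂ : ℝ)
    (ht₀ : 1 ≤ t₀) (ha : b + 3 ≤ a) (hb : 0 ≤ b)
    (hθ1 : 1 / (a - 1) ≤ θ) (hθ2 : θ ≤ 1 / (b + 2))
    (hL₁ : 0 < L₁) (hL₂ : 0 < L₂)
    (f : EuclideanSpace ℝ (Fin n) → ℝ) (g : EuclideanSpace ℝ (Fin m) → ℝ)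
    (hf : Differentiable ℝ f) (hg : Differentiable ℝ g)
    (hfconv : ConvexOn ℝ Set.univ f) (hgconv : ConvexOn ℝ Set.univ g)
    (hfLip : ∀ u v, ‖gradient f u - gradient f v‖ ≤ L₁ * ‖u - v‖)
    (hgLip : ∀ u v, ‖gradient g u - gradient g v‖ ≤ L₂ * ‖u - v‖)
    (K : EuclideanSpace ℝ (Fin n) →L[ℝ] EuclideanSpace ℝ (Fin m))
    (ε : ℝ → ℝ) (hεC1 : ContDiffOn ℝ 1 ε (Set.Ici t₀))
    (hεpos : ∀ t ≥ t₀, 0 < ε t) (hεanti : AntitoneOn ε (Set.Ici t₀))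
    (x : ℝ → EuclideanSpace ℝ (Fin n)) (y : ℝ → EuclideanSpace ℝ (Fin m))
    (hsol : IsSol t₀ θ f g K (fun t => a / t) (fun t => t ^ b) ε x y)
    (xs : EuclideanSpace ℝ (Fin n)) (ys : EuclideanSpace ℝ (Fin m))
    (hsaddle : IsSaddle f g K xs ys) :
    (IntegrableOn (fun t => t ^ (b + 1) * ε t) (Set.Ioi t₀) →
      (∃ M : ℝ, ∀ t ≥ t₀, ‖x t‖ ≤ M ∧ ‖y t‖ ≤ M) ∧
      (∃ C > 0, ∀ t ≥ t₀,
        Lag f g K (x t) ys - Lag f g K xs (y t) ≤ C * t ^ (-b - 2) ∧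
        ‖deriv x t‖ ≤ C / t ∧ ‖deriv y t‖ ≤ C / t ∧
        ‖gradient f (x t) - gradient f xs‖ ≤ C * t ^ (-(b + 2) / 2) ∧
        ‖gradient g (y t) - gradient g ys‖ ≤ C * t ^ (-(b + 2) / 2)) ∧
      (1 / (a - 1) < θ →
        IntegrableOn (fun t => t * (‖deriv x t‖ ^ 2 + ‖deriv y t‖ ^ 2)) (Set.Ioi t₀)) ∧
      (θ < 1 / (b + 2) →
        IntegrableOn
          (fun t => t ^ (b + 1) * (Lag f g K (x t) ys - Lag f g K xs (y t)))
          (Set.Ioi t₀) ∧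
        IntegrableOn
          (fun t => t ^ (b + 1) * ‖gradient f (x t) - gradient f xs‖ ^ 2)
          (Set.Ioi t₀) ∧
        IntegrableOn
          (fun t => t ^ (b + 1) * ‖gradient g (y t) - gradient g ys‖ ^ 2)
          (Set.Ioi t₀))) ∧
    (IntegrableOn (fun t => t ^ (b - 1) * ε t) (Set.Ioi t₀) →
      Tendsto (fun t => ‖deriv x t‖) atTop (nhds 0) ∧
      Tendsto (fun t => ‖deriv y t‖) atTop (nhds 0) ∧
      Tendsto (fun t => Lag f g K (x t) ys - Lag f g K xs (y t)) atTop (nhds 0) ∧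
      (0 < b →
        ((fun t => Lag f g K (x t) ys - Lag f g K xs (y t)) =o[atTop]
          fun t => t ^ (-b)) ∧
        ((fun t => ‖gradient f (x t) - gradient f xs‖) =o[atTop]
          fun t => t ^ (-b / 2)) ∧
        ((fun t => ‖gradient g (y t) - gradient g ys‖) =o[atTop]
          fun t => t ^ (-b / 2)))) := by
  have hab : 0 < a - 1 := by linarith
  have hθa : 1 ≤ θ * (a - 1) := (div_le_iff₀ hab).1 hθ1
  have hb2 : 0 < b + 2 := by linarith
  have hθb : (b + 2) * θ ≤ 1 := by
    have := (le_div_iff₀ hb2).1 hθ2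
    linarith
  have hθ : 0 < θ := lt_of_lt_of_le (by positivity) hθ1
  obtain ⟨hx2, hy2, hode⟩ := hsol
  obtain ⟨vx, hxc, hvxc, hxd, hvx, hvxd⟩ := aux_traj t₀ x hx2
  obtain ⟨vy, hyc, hvyc, hyd, hvy, hvyd⟩ := aux_traj t₀ y hy2
  have hgf : gradient f xs = -(ContinuousLinearMap.adjoint K ys) := by
    refine aux_opt f hf _ xs fun u => ?_
    have h1 := (hsaddle u ys).2
    simp only [Lag] at h1
    rw [ContinuousLinearMap.adjoint_inner_left, ContinuousLinearMap.adjoint_inner_left,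
      real_inner_comm, real_inner_comm (K u)]
    linarith
  have hgg : gradient g ys = K xs := by
    have := aux_opt g hg (-(K xs)) ys fun u => ?_
    · rw [this, neg_neg]
    · have h1 := (hsaddle xs u).1
      simp only [Lag] at h1
      rw [inner_neg_left, inner_neg_left]
      linarith
  have hcf : Continuous (gradient f) :=
    (LipschitzWith.of_dist_le_mul (K := L₁.toNNReal) fun u w => by
      rw [dist_eq_norm, dist_eq_norm, Real.coe_toNNReal _ hL₁.le]; exact hfLip u w).continuous
  have hcg : Continuous (gradient g) :=
    (LipschitzWith.of_dist_le_mul (K := L₂.toNNReal) fun u w => by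
      rw [dist_eq_norm, dist_eq_norm, Real.coe_toNNReal _ hL₂.le]; exact hgLip u w).continuous
  set κ := min (1 / (2 * L₁)) (1 / (2 * L₂)) with hκd
  have hκ : 0 < κ := lt_min (by positivity) (by positivity)
  set h : ℝ → ℝ := fun t => Lag f g K (x t) ys - Lag f g K xs (y t) with hh
  have hheq : ∀ t, h t = (f (x t) - f xs - ⟪gradient f xs, x t - xs⟫)
      + (g (y t) - g ys - ⟪gradient g ys, y t - ys⟫) := by
    intro t
    simp only [hh, Lag, hgf, hgg, inner_neg_left, inner_sub_right,
      ContinuousLinearMap.adjoint_inner_left]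
    rw [real_inner_comm ys (K (x t)), real_inner_comm ys (K xs)]
    ring
  have hεd : ∀ t > t₀, HasDerivAt ε (deriv ε t) t := fun t ht =>
    ((hεC1.contDiffAt (Ici_mem_nhds ht)).differentiableAt (by norm_num)).hasDerivAt
  have hεd' : ∀ t > t₀, deriv ε t ≤ 0 := fun t ht => by
    rw [← derivWithin_of_mem_nhds (Ici_mem_nhds ht)]
    exact hεanti.derivWithin_nonpos
  have hmain := aux_abs (V := WithLp 2 (EuclideanSpace ℝ (Fin n) × EuclideanSpace ℝ (Fin m)))
    t₀ θ a b κ ht₀ hθ hθb hθa hκ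
    (fun t => WithLp.toLp 2 (x t, y t)) (fun t => WithLp.toLp 2 (vx t, vy t))
    (fun t => WithLp.toLp 2 (gradient f (x t) - gradient f xs, gradient g (y t) - gradient g ys))
    (fun t => WithLp.toLp 2 (ContinuousLinearMap.adjoint K (y t - ys + (θ * t) • vy t),
      -(K (x t - xs + (θ * t) • vx t))))
    (WithLp.toLp 2 (xs, ys)) h ε (deriv ε)
    (aux_toLp_cont _ _ _ hxc hyc) (aux_toLp_cont _ _ _ hvxc hvyc)
    (aux_toLp_cont _ _ _ ((hcf.comp_continuousOn hxc).sub continuousOn_const)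
      ((hcg.comp_continuousOn hyc).sub continuousOn_const))
    (by
      have hfc := hf.continuous.comp_continuousOn hxc
      have hgc := hg.continuous.comp_continuousOn hyc
      rw [show h = fun t => _ from funext hheq]
      exact ((hfc.sub continuousOn_const).sub
        (continuousOn_const.inner (hxc.sub continuousOn_const))).add
        ((hgc.sub continuousOn_const).sub
          (continuousOn_const.inner (hyc.sub continuousOn_const))))
    hεC1.continuousOn
    (fun t ht => aux_toLp_deriv _ _ _ _ t (hxd t ht) (hyd t ht))
    (fun t ht => by
      refine (aux_toLp_deriv _ _ _ _ t (hvxd t ht) (hvyd t ht)).congr_deriv ?_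
      obtain ⟨e1, e2⟩ := hode t ht.le
      simp only [← hvx t ht, ← hvy t ht] at e1 e2
      rw [aux_toLp_smul, aux_toLp_smul, aux_toLp_add, aux_toLp_add, aux_toLp_smul, aux_toLp_sub]
      congr 1
      refine Prod.ext ?_ ?_
      · simp only [hgf]
        simp only [map_add, map_sub, map_smul] at e1 ⊢
        rw [← sub_eq_zero, ← e1]
        module
      · simp only [hgg]
        simp only [map_add, map_sub, map_smul] at e2 ⊢
        rw [← sub_eq_zero, ← e2]
        module)
    (fun t ht => by
      rw [aux_toLp_smul, aux_toLp_sub, aux_toLp_add, aux_toLp_inner, ContinuousLinearMap.adjoint_inner_left, inner_neg_left, real_inner_comm]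
      ring)
    (fun t ht => by
      rw [show h = fun t => _ from funext hheq, aux_toLp_inner]
      have h1 : HasDerivAt (fun t => f (x t)) ⟪gradient f (x t), vx t⟫ t :=
        (hf (x t)).hasGradientAt.hasFDerivAt.comp_hasDerivAt t (hxd t ht)
      have h2 : HasDerivAt (fun t => g (y t)) ⟪gradient g (y t), vy t⟫ t :=
        (hg (y t)).hasGradientAt.hasFDerivAt.comp_hasDerivAt t (hyd t ht)
      have h3 := (hasDerivAt_const t (gradient f xs)).inner ℝ ((hxd t ht).sub_const xs)
      have h4 := (hasDerivAt_const t (gradient g ys)).inner ℝ ((hyd t ht).sub_const ys)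
      refine (((h1.sub_const (f xs)).sub h3).add ((h2.sub_const (g ys)).sub h4)).congr_deriv ?_
      rw [inner_sub_left, inner_sub_left, inner_zero_left, inner_zero_left]
      ring)
    hεd hεpos hεd'
    (fun t ht => by
      have h1 := aux_cocoercive f L₁ hL₁ hf hfconv hfLip (x t) xs
      have h2 := aux_cocoercive g L₂ hL₂ hg hgconv hgLip (y t) ys
      rw [aux_toLp_sub, aux_toLp_inner, aux_toLp_norm, hheq t,
        inner_sub_left, inner_sub_left]
      rw [← neg_sub (x t) xs, inner_neg_right, norm_sub_rev] at h1
      rw [← neg_sub (y t) ys, inner_neg_right, norm_sub_rev] at h2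
      have h3 : κ * ‖gradient f (x t) - gradient f xs‖ ^ 2 ≤
        1 / (2 * L₁) * ‖gradient f (x t) - gradient f xs‖ ^ 2 :=
        mul_le_mul_of_nonneg_right (min_le_left _ _) (by positivity)
      have h4 : κ * ‖gradient g (y t) - gradient g ys‖ ^ 2 ≤
        1 / (2 * L₂) * ‖gradient g (y t) - gradient g ys‖ ^ 2 :=
        mul_le_mul_of_nonneg_right (min_le_right _ _) (by positivity)
      linarith)
    (fun t ht => by
      have h1 := aux_cocoercive f L₁ hL₁ hf hfconv hfLip xs (x t)
      have h2 := aux_cocoercive g L₂ hL₂ hg hgconv hgLip ys (y t)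
      rw [aux_toLp_norm, hheq t]
      have h3 : κ * ‖gradient f (x t) - gradient f xs‖ ^ 2 ≤
        1 / (2 * L₁) * ‖gradient f (x t) - gradient f xs‖ ^ 2 :=
        mul_le_mul_of_nonneg_right (min_le_left _ _) (by positivity)
      have h4 : κ * ‖gradient g (y t) - gradient g ys‖ ^ 2 ≤
        1 / (2 * L₂) * ‖gradient g (y t) - gradient g ys‖ ^ 2 :=
        mul_le_mul_of_nonneg_right (min_le_right _ _) (by positivity)
      linarith)
  simp only [aux_toLp_sub, aux_toLp_norm] at hmain
  have hpos : ∀ t ≥ t₀, 0 < t := fun t ht => by linarith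
  have hh0 : ∀ t, 0 ≤ h t := fun t => by
    have h1 := aux_grad_ineq f hf hfconv xs (x t)
    have h2 := aux_grad_ineq g hg hgconv ys (y t)
    rw [hheq t]; linarith
  have hgfc : ContinuousOn (fun t => gradient f (x t)) (Set.Ici t₀) := hcf.comp_continuousOn hxc
  have hggc : ContinuousOn (fun t => gradient g (y t)) (Set.Ici t₀) := hcg.comp_continuousOn hyc
  have hrpc : ContinuousOn (fun t : ℝ => t ^ (b + 1)) (Set.Ioi t₀) :=
    continuousOn_id.rpow_const fun s hs => Or.inl (by
      have : t₀ < s := hs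
      simp only [id]; linarith)
  constructor
  · intro hI
    obtain ⟨⟨M, hM0, hM⟩, hv, hhi, hγi⟩ := hmain.1 hI
    have hsM := Real.sqrt_nonneg M
    refine ⟨⟨√M + ‖xs‖ + ‖ys‖, fun t ht => ?_⟩,
      ⟨M + √M + 1 + ‖deriv x t₀‖ * t₀ + ‖deriv y t₀‖ * t₀, by positivity, fun t ht => ?_⟩, ?_, ?_⟩
    · obtain ⟨h1, -⟩ := hM t ht
      have h2 : ‖x t - xs‖ ≤ √M :=
        Real.le_sqrt_of_sq_le (by linarith [sq_nonneg ‖y t - ys‖])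
      have h3 : ‖y t - ys‖ ≤ √M :=
        Real.le_sqrt_of_sq_le (by linarith [sq_nonneg ‖x t - xs‖])
      have h4 := norm_le_norm_sub_add (x t) xs
      have h5 := norm_le_norm_sub_add (y t) ys
      constructor <;> linarith [norm_nonneg xs, norm_nonneg ys]
    · obtain ⟨-, h1, h2, h3⟩ := hM t ht
      have htp := hpos t ht
      have n1 : 0 ≤ ‖deriv x t₀‖ * t₀ := by positivity
      have n2 : 0 ≤ ‖deriv y t₀‖ * t₀ := by positivity
      have hgr : ∀ G : ℝ, 0 ≤ G → t ^ (b + 2) * G ^ 2 ≤ M →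
          G ≤ (M + √M + 1 + ‖deriv x t₀‖ * t₀ + ‖deriv y t₀‖ * t₀) * t ^ (-(b + 2) / 2) := by
        intro G hG hGM
        have hp : 0 < t ^ ((b + 2) / 2) := Real.rpow_pos_of_pos htp _
        have e1 : t ^ (b + 2) = (t ^ ((b + 2) / 2)) ^ 2 := by
          rw [← Real.rpow_natCast, ← Real.rpow_mul htp.le]; congr 1; push_cast; ring
        rw [e1, ← mul_pow] at hGM
        have e2 := Real.le_sqrt_of_sq_le hGM
        rw [neg_div, Real.rpow_neg htp.le, ← div_eq_mul_inv, le_div_iff₀ hp]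
        linarith
      have hve : ∀ G G₀ : ℝ, 0 ≤ G → t ^ 2 * G ^ 2 ≤ M → G * t ≤ √M := by
        intro G G₀ hG hGM
        rw [← mul_pow] at hGM
        have e2 := Real.le_sqrt_of_sq_le hGM
        linarith
      have hx' : ‖deriv x t‖ * t ≤ √M + ‖deriv x t₀‖ * t₀ := by
        rcases eq_or_lt_of_le (show t₀ ≤ t from ht) with rfl | hlt
        · linarith
        · rw [← hvx t hlt]
          have := hve ‖vx t‖ 0 (norm_nonneg _) (by nlinarith [mul_nonneg (sq_nonneg t) (sq_nonneg ‖vy t‖)])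
          linarith
      have hy' : ‖deriv y t‖ * t ≤ √M + ‖deriv y t₀‖ * t₀ := by
        rcases eq_or_lt_of_le (show t₀ ≤ t from ht) with rfl | hlt
        · linarith
        · rw [← hvy t hlt]
          have := hve ‖vy t‖ 0 (norm_nonneg _) (by nlinarith [mul_nonneg (sq_nonneg t) (sq_nonneg ‖vx t‖)])
          linarith
      have hTp : 0 < t ^ (b + 2) := Real.rpow_pos_of_pos htp _
      refine ⟨?_, ?_, ?_, ?_, ?_⟩
      · rw [show -b - 2 = -(b + 2) by ring, Real.rpow_neg htp.le, ← div_eq_mul_inv,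
          le_div_iff₀ hTp]
        have : h t * t ^ (b + 2) ≤ M := by linarith
        simp only [hh] at this
        linarith
      · rw [le_div_iff₀ htp]; linarith
      · rw [le_div_iff₀ htp]; linarith
      · refine hgr _ (norm_nonneg _) ?_
        nlinarith [mul_nonneg hTp.le (sq_nonneg ‖gradient g (y t) - gradient g ys‖)]
      · refine hgr _ (norm_nonneg _) ?_
        nlinarith [mul_nonneg hTp.le (sq_nonneg ‖gradient f (x t) - gradient f xs‖)]
    · intro hlt
      refine (hv ((div_lt_iff₀ hab).1 hlt)).congr_fun (fun t ht => ?_) measurableSet_Ioi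
      simp only [hvx t ht, hvy t ht]
    · intro hlt
      have hlt' := (lt_div_iff₀ hb2).1 hlt
      refine ⟨hhi (by linarith), ?_, ?_⟩
      · refine Integrable.mono' hγi ?_ ?_
        · refine ContinuousOn.aestronglyMeasurable ?_ measurableSet_Ioi
          have := hgfc.mono Set.Ioi_subset_Ici_self
          fun_prop
        · filter_upwards [ae_restrict_mem measurableSet_Ioi] with t ht
          have hT : 0 ≤ t ^ (b + 1) := Real.rpow_nonneg (hpos t (le_of_lt ht)).le _
          rw [Real.norm_of_nonneg (by positivity)]
          exact mul_le_mul_of_nonneg_left (le_add_of_nonneg_right (sq_nonneg _)) hT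
      · refine Integrable.mono' hγi ?_ ?_
        · refine ContinuousOn.aestronglyMeasurable ?_ measurableSet_Ioi
          have := hggc.mono Set.Ioi_subset_Ici_self
          fun_prop
        · filter_upwards [ae_restrict_mem measurableSet_Ioi] with t ht
          have hT : 0 ≤ t ^ (b + 1) := Real.rpow_nonneg (hpos t (le_of_lt ht)).le _
          rw [Real.norm_of_nonneg (by positivity)]
          exact mul_le_mul_of_nonneg_left (le_add_of_nonneg_left (sq_nonneg _)) hT
  · intro hI
    obtain ⟨hv, hhT, hγT⟩ := hmain.2 hI
    have hrpow : ∀ t ≥ t₀, ∀ G : ℝ, (G / t ^ (-b / 2)) ^ 2 = t ^ b * G ^ 2 := by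
      intro t ht G
      have htp := hpos t ht
      have e1 : t ^ b = (t ^ (b / 2)) ^ 2 := by
        rw [← Real.rpow_natCast, ← Real.rpow_mul htp.le]; congr 1; push_cast; ring
      rw [neg_div, Real.rpow_neg htp.le, div_inv_eq_mul, mul_pow, e1, mul_comm]
    refine ⟨?_, ?_, ?_, fun hbp => ⟨?_, ?_, ?_⟩⟩
    · refine aux_sq_tendsto _ _ (fun t => norm_nonneg _) ?_ hv
      filter_upwards [eventually_gt_atTop t₀] with t ht
      rw [← hvx t ht]
      exact le_add_of_nonneg_right (sq_nonneg _)
    · refine aux_sq_tendsto _ _ (fun t => norm_nonneg _) ?_ hv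
      filter_upwards [eventually_gt_atTop t₀] with t ht
      rw [← hvy t ht]
      exact le_add_of_nonneg_left (sq_nonneg _)
    · refine squeeze_zero' (Eventually.of_forall hh0) ?_ hhT
      filter_upwards [eventually_ge_atTop t₀] with t ht
      exact le_mul_of_one_le_left (hh0 t) (Real.one_le_rpow (by linarith) hb)
    · rw [isLittleO_iff_tendsto']
      · refine hhT.congr' ?_
        filter_upwards [eventually_ge_atTop t₀] with t ht
        rw [Real.rpow_neg (hpos t ht).le, div_inv_eq_mul, mul_comm]
      · filter_upwards [eventually_ge_atTop t₀] with t ht h0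
        exact absurd h0 (Real.rpow_pos_of_pos (hpos t ht) _).ne'
    · rw [← isLittleO_abs_right, isLittleO_iff_tendsto']
      · refine aux_sq_tendsto _ _ (fun t => by positivity) ?_ hγT
        filter_upwards [eventually_ge_atTop t₀] with t ht
        have htp := Real.rpow_pos_of_pos (hpos t ht) (-b / 2)
        have hTp := Real.rpow_pos_of_pos (hpos t ht) b
        rw [abs_of_pos htp, hrpow t ht]
        exact mul_le_mul_of_nonneg_left (le_add_of_nonneg_right (sq_nonneg _)) hTp.le
      · filter_upwards [eventually_ge_atTop t₀] with t ht h0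
        exact absurd (abs_eq_zero.1 h0) (Real.rpow_pos_of_pos (hpos t ht) _).ne'
    · rw [← isLittleO_abs_right, isLittleO_iff_tendsto']
      · refine aux_sq_tendsto _ _ (fun t => by positivity) ?_ hγT
        filter_upwards [eventually_ge_atTop t₀] with t ht
        have htp := Real.rpow_pos_of_pos (hpos t ht) (-b / 2)
        have hTp := Real.rpow_pos_of_pos (hpos t ht) b
        rw [abs_of_pos htp, hrpow t ht]
        exact mul_le_mul_of_nonneg_left (le_add_of_nonneg_left (sq_nonneg _)) hTp.le
      · filter_upwards [eventually_ge_atTop t₀] with t ht h0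
        exact absurd (abs_eq_zero.1 h0) (Real.rpow_pos_of_pos (hpos t ht) _).ne'
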